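/- arXiv:1909.05047 — 3 statements merged into one kernel-verified Lean document; each statement's English description precedes it below -/
import Mathlib

section
/- The function I(x) = (∫_0^x π_μ(z) m'(z) dz) / m(0,x) is differentiable on (0,∞) with I'(x) = −(m'(x)/m(0,x)²) H(0,x); consequently I'(x) < 0 for 0 < x < x̂, I'(x̂) = 0, and I'(x) > 0 for x > x̂, where x̂ ∈ (x*, ∞) is the unique root of x ↦ H(0,x). -/
open MeasureTheory Filter

/-- Fundamental theorem of calculus for a continuous function on `(0, ∞)` integrable near `0`. -/
theorem hasDerivAt_setIntegral_Ioc_zero {g : ℝ → ℝ} (hg : ContinuousOn g (Set.Ioi 0)) {x : ℝ}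
    (hx : 0 < x) (hgi : IntegrableOn g (Set.Ioc 0 x)) :
    HasDerivAt (fun y => ∫ z in Set.Ioc 0 y, g z) (g x) x := by
  have h := intervalIntegral.integral_hasDerivAt_right
    ((intervalIntegrable_iff_integrableOn_Ioc_of_le hx.le).2 hgi)
    (hg.stronglyMeasurableAtFilter isOpen_Ioi x hx) (hg.continuousAt (Ioi_mem_nhds hx))
  refine h.congr_of_eventuallyEq ?_
  filter_upwards [Ioi_mem_nhds hx] with y hy
  exact (intervalIntegral.integral_of_le (le_of_lt hy)).symm

theorem continuousOn_intervalIntegral_Ioi {g : ℝ → ℝ} (hg : ContinuousOn g (Set.Ioi 0)) {c : ℝ}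
    (hc : 0 < c) : ContinuousOn (fun x => ∫ z in c..x, g z) (Set.Ioi 0) := by
  intro x hx
  have hsub : Set.uIcc c x ⊆ Set.Ioi 0 := fun z hz => (lt_min hc hx).trans_le hz.1
  exact (intervalIntegral.integral_hasDerivAt_right (hg.mono hsub).intervalIntegrable
    (hg.stronglyMeasurableAtFilter isOpen_Ioi x hx)
    (hg.continuousAt (Ioi_mem_nhds hx))).continuousAt.continuousWithinAt

theorem setIntegral_Ioc_pos {f : ℝ → ℝ} {a b : ℝ} (hab : a < b)
    (hf : ∀ z ∈ Set.Ioo a b, 0 < f z) (hfi : IntegrableOn f (Set.Ioc a b)) :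
    0 < ∫ z in Set.Ioc a b, f z := by
  rw [← intervalIntegral.integral_of_le hab.le]
  exact intervalIntegral.intervalIntegral_pos_of_pos_on
    ((intervalIntegrable_iff_integrableOn_Ioc_of_le hab.le).2 hfi) hf hab

theorem setIntegral_Ioc_add_adjacent {f : ℝ → ℝ} {a b d : ℝ} (hab : a ≤ b) (hbd : b ≤ d)
    (hf : IntegrableOn f (Set.Ioc a d)) :
    ∫ z in Set.Ioc a d, f z = (∫ z in Set.Ioc a b, f z) + ∫ z in Set.Ioc b d, f z := by
  rw [← Set.Ioc_union_Ioc_eq_Ioc hab hbd]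
  exact setIntegral_union (Set.Ioc_disjoint_Ioc_of_le le_rfl) measurableSet_Ioc
    (hf.mono_set (Set.Ioc_subset_Ioc_right hbd)) (hf.mono_set (Set.Ioc_subset_Ioc_left hab))

theorem mul_setIntegral_Ioc_lt {p w : ℝ → ℝ} {a b k : ℝ} (hab : a < b)
    (hw : ∀ z ∈ Set.Ioo a b, 0 < w z) (hp : ∀ z ∈ Set.Ioo a b, k < p z)
    (hwi : IntegrableOn w (Set.Ioc a b)) (hpi : IntegrableOn (fun z => p z * w z) (Set.Ioc a b)) :
    k * ∫ z in Set.Ioc a b, w z < ∫ z in Set.Ioc a b, p z * w z := by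
  have h := setIntegral_Ioc_pos (f := fun z => p z * w z - k * w z) hab
    (fun z hz => by nlinarith [hw z hz, hp z hz]) (hpi.sub (hwi.const_mul k))
  rw [integral_sub hpi (hwi.const_mul k), integral_const_mul] at h
  linarith

theorem setIntegral_Ioc_lt_mul {p w : ℝ → ℝ} {a b k : ℝ} (hab : a < b)
    (hw : ∀ z ∈ Set.Ioo a b, 0 < w z) (hp : ∀ z ∈ Set.Ioo a b, p z < k)
    (hwi : IntegrableOn w (Set.Ioc a b)) (hpi : IntegrableOn (fun z => p z * w z) (Set.Ioc a b)) :
    ∫ z in Set.Ioc a b, p z * w z < k * ∫ z in Set.Ioc a b, w z := by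
  have h := setIntegral_Ioc_pos (f := fun z => k * w z - p z * w z) hab
    (fun z hz => by nlinarith [hw z hz, hp z hz]) ((hwi.const_mul k).sub hpi)
  rw [integral_sub (hwi.const_mul k) hpi, integral_const_mul] at h
  linarith

/-- The function I(x) = (∫_0^x π_μ m') / m(0,x) is differentiable on
    (0,∞) with I'(x) = −(m'(x)/m(0,x)²) H(0,x); consequently I' < 0 on (0,x̂),
    I'(x̂) = 0, and I' > 0 on (x̂,∞), where x̂ ∈ (x*,∞) is the unique root of H. -/
theorem stmt_6
    (μ σ pf : ℝ → ℝ) (c : ℝ) (hc : 0 < c)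
    (hμc : ContinuousOn μ (Set.Ioi 0)) (hσc : ContinuousOn σ (Set.Ioi 0))
    (hσ : ∀ x > 0, 0 < σ x)
    (S' m' : ℝ → ℝ)
    (hS'def : ∀ x > 0, S' x = Real.exp (-(∫ z in c..x, 2 * μ z / σ z ^ 2)))
    (hm'def : ∀ x > 0, m' x = 2 / (σ x ^ 2 * S' x))
    (m0 : ℝ → ℝ) (hm0def : ∀ x > 0, m0 x = ∫ z in Set.Ioc 0 x, m' z)
    (hpfc : ContinuousOn pf (Set.Ioi 0)) (hpfnn : ∀ x > 0, 0 ≤ pf x)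
    (γ : ℝ) (hγ : 0 < γ)
    (pmu : ℝ → ℝ) (hpmudef : ∀ x > 0, pmu x = pf x + γ * μ x)
    (H : ℝ → ℝ)
    (hHdef : ∀ x > 0, H x = (∫ z in Set.Ioc 0 x, pmu z * m' z) - pmu x * m0 x)
    (xstar : ℝ) (hxstar : 0 < xstar)
    (hdec : StrictAntiOn pmu (Set.Ioo 0 xstar))
    (hinc : StrictMonoOn pmu (Set.Ici xstar))
    (hlimpos : ∃ ε > 0, ∀ᶠ x in atTop, ε ≤ pmu x)
    (hmi : ∀ y > 0, IntegrableOn m' (Set.Ioc 0 y))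
    (hpmi : ∀ y > 0, IntegrableOn (fun z => pmu z * m' z) (Set.Ioc 0 y))
    (xh : ℝ) (hxh : xh ∈ Set.Ioi xstar) (hHxh : H xh = 0)
    (hxhu : ∀ x > 0, H x = 0 → x = xh) :
    (∀ x > 0, HasDerivAt (fun y => (∫ z in Set.Ioc 0 y, pmu z * m' z) / m0 y)
        (-(m' x / m0 x ^ 2) * H x) x) ∧
    (∀ x, 0 < x → x < xh → -(m' x / m0 x ^ 2) * H x < 0) ∧
    -(m' xh / m0 xh ^ 2) * H xh = 0 ∧
    (∀ x, xh < x → 0 < -(m' x / m0 x ^ 2) * H x) := by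
  have hS'c : ContinuousOn S' (Set.Ioi 0) :=
    (continuousOn_intervalIntegral_Ioi ((continuousOn_const.mul hμc).div (hσc.pow 2)
      fun z hz => (pow_pos (hσ z hz) 2).ne') hc).neg.rexp.congr hS'def
  have hden : ∀ x > 0, 0 < σ x ^ 2 * S' x := fun x hx =>
    mul_pos (pow_pos (hσ x hx) 2) (by rw [hS'def x hx]; exact Real.exp_pos _)
  have hm'c : ContinuousOn m' (Set.Ioi 0) :=
    (continuousOn_const.div ((hσc.pow 2).mul hS'c) fun z hz => (hden z hz).ne').congr hm'def
  have hm'pos : ∀ x > 0, 0 < m' x := fun x hx => by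
    rw [hm'def x hx]; exact div_pos two_pos (hden x hx)
  have hpc : ContinuousOn pmu (Set.Ioi 0) :=
    (hpfc.add (continuousOn_const.mul hμc)).congr hpmudef
  have hm0pos : ∀ x > 0, 0 < m0 x := fun x hx => by
    rw [hm0def x hx]
    exact setIntegral_Ioc_pos hx (fun z hz => hm'pos z hz.1) (hmi x hx)
  have hHpos : ∀ x, 0 < x → x < xstar → 0 < H x := fun x hx hxs => by
    rw [hHdef x hx, hm0def x hx, sub_pos]
    exact mul_setIntegral_Ioc_lt hx (fun z hz => hm'pos z hz.1)
      (fun z hz => hdec ⟨hz.1, hz.2.trans hxs⟩ ⟨hx, hxs⟩ hz.2) (hmi x hx) (hpmi x hx)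
  have hHanti : StrictAntiOn H (Set.Ici xstar) := by
    intro x hx y hy hxy
    have hx0 : 0 < x := hxstar.trans_le hx
    have hy0 : 0 < y := hx0.trans hxy
    have hsub : Set.Ioc x y ⊆ Set.Ioc 0 y := Set.Ioc_subset_Ioc_left hx0.le
    have hlt := setIntegral_Ioc_lt_mul hxy (fun z hz => hm'pos z (hx0.trans hz.1))
      (fun z hz => hinc (le_trans hx hz.1.le) hy hz.2)
      ((hmi y hy0).mono_set hsub) ((hpmi y hy0).mono_set hsub)
    have hm0 := hm0pos x hx0
    have hp := hinc hx hy hxy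
    rw [hHdef x hx0, hHdef y hy0, hm0def y hy0,
      setIntegral_Ioc_add_adjacent hx0.le hxy.le (hpmi y hy0),
      setIntegral_Ioc_add_adjacent hx0.le hxy.le (hmi y hy0), ← hm0def x hx0]
    nlinarith [mul_pos (sub_pos.2 hp) hm0]
  have hfac : ∀ x > 0, 0 < m' x / m0 x ^ 2 := fun x hx =>
    div_pos (hm'pos x hx) (pow_pos (hm0pos x hx) 2)
  refine ⟨fun x hx => ?_, fun x hx hxx => ?_, by rw [hHxh, mul_zero], fun x hxx => ?_⟩
  · have hm0d : HasDerivAt m0 (m' x) x :=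
      (hasDerivAt_setIntegral_Ioc_zero hm'c hx (hmi x hx)).congr_of_eventuallyEq
        (Filter.eventually_of_mem (Ioi_mem_nhds hx) hm0def)
    have hne := (hm0pos x hx).ne'
    refine ((hasDerivAt_setIntegral_Ioc_zero (hpc.mul hm'c) hx (hpmi x hx)).div hm0d
      hne).congr_deriv ?_
    rw [hHdef x hx]
    simp only [Pi.mul_apply]
    field_simp
    ring
  · have hH : 0 < H x := by
      rcases lt_or_ge x xstar with h | h
      · exact hHpos x hx h
      · exact hHxh ▸ hHanti h (Set.Ioi_subset_Ici_self hxh) hxx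
    rw [neg_mul]
    exact neg_neg_of_pos (mul_pos (hfac x hx) hH)
  · have hxh' : xstar < xh := hxh
    have hH : H x < 0 := hHxh ▸ hHanti hxh'.le (hxh'.trans hxx).le hxx
    exact mul_pos_of_neg_of_neg
      (neg_neg_of_pos (hfac x (hxstar.trans (hxh'.trans hxx)))) hH
end

section
/- The function J(x) = (γ − (R_λπ_γ)'(x)) / φ_λ'(x) is differentiable on (0,∞) and satisfies J'(x) = (2 S'(x) / (σ²(x) φ_λ'(x)²)) L(x) for all x > 0. -/
open MeasureTheory Filter

section HalfLine

variable {f : ℝ → ℝ}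

lemma stronglyMeasurableAtFilter_of_continuousOn_Ioi (hf : ContinuousOn f (Set.Ioi 0))
    {x : ℝ} (hx : 0 < x) : StronglyMeasurableAtFilter f (nhds x) :=
  hf.stronglyMeasurableAtFilter isOpen_Ioi x hx

lemma intervalIntegrable_of_continuousOn_Ioi (hf : ContinuousOn f (Set.Ioi 0))
    {a b : ℝ} (ha : 0 < a) (hb : 0 < b) : IntervalIntegrable f volume a b :=
  (hf.mono fun _ hz => lt_of_lt_of_le (lt_min ha hb) hz.1).intervalIntegrable

lemma hasDerivAt_integral_of_continuousOn_Ioi (hf : ContinuousOn f (Set.Ioi 0))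
    {a x : ℝ} (ha : 0 < a) (hx : 0 < x) :
    HasDerivAt (fun y => ∫ z in a..y, f z) (f x) x :=
  intervalIntegral.integral_hasDerivAt_right (intervalIntegrable_of_continuousOn_Ioi hf ha hx)
    (stronglyMeasurableAtFilter_of_continuousOn_Ioi hf hx)
    (hf.continuousAt (Ioi_mem_nhds hx))

lemma hasDerivAt_setIntegral_Ioi (hf : ContinuousOn f (Set.Ioi 0))
    (hint : ∀ x > 0, IntegrableOn f (Set.Ioi x)) {x : ℝ} (hx : 0 < x) :
    HasDerivAt (fun y => ∫ z in Set.Ioi y, f z) (-f x) x := by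
  refine ((hasDerivAt_integral_of_continuousOn_Ioi hf hx hx).const_sub
    (∫ z in Set.Ioi x, f z)).congr_of_eventuallyEq ?_
  filter_upwards [Ioi_mem_nhds hx] with y hy
  rw [← intervalIntegral.integral_interval_add_Ioi (hint x hx) (hint y hy)]
  ring

lemma hasDerivAt_setIntegral_Ioc (hf : ContinuousOn f (Set.Ioi 0))
    (hint : ∀ x > 0, IntegrableOn f (Set.Ioc 0 x)) {x : ℝ} (hx : 0 < x) :
    HasDerivAt (fun y => ∫ z in Set.Ioc 0 y, f z) (f x) x := by
  refine (intervalIntegral.integral_hasDerivAt_right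
    ((intervalIntegrable_iff_integrableOn_Ioc_of_le hx.le).2 (hint x hx))
    (stronglyMeasurableAtFilter_of_continuousOn_Ioi hf hx)
    (hf.continuousAt (Ioi_mem_nhds hx))).congr_of_eventuallyEq ?_
  filter_upwards [Ioi_mem_nhds hx] with y hy
  rw [intervalIntegral.integral_of_le (le_of_lt hy)]

lemma integrableOn_of_continuousOn_of_abs_le {g : ℝ → ℝ} {s : Set ℝ} (hs : MeasurableSet s)
    (hg : IntegrableOn g s) (hf : ContinuousOn f s) (h : ∀ z ∈ s, |f z| ≤ g z) :
    IntegrableOn f s :=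
  Integrable.mono' hg (hf.aestronglyMeasurable hs)
    ((ae_restrict_iff' hs).2 (Eventually.of_forall h))

lemma deriv_nonneg_of_monotoneOn_Ioi (hf : MonotoneOn f (Set.Ioi 0)) {f' x : ℝ} (hx : 0 < x)
    (hd : HasDerivAt f f' x) : 0 ≤ f' := by
  have h := hf.derivWithin_nonneg (x := x)
  rwa [derivWithin_of_isOpen isOpen_Ioi hx, hd.deriv] at h

lemma deriv_nonpos_of_antitoneOn_Ioi (hf : AntitoneOn f (Set.Ioi 0)) {f' x : ℝ} (hx : 0 < x)
    (hd : HasDerivAt f f' x) : f' ≤ 0 := by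
  have h := hf.derivWithin_nonpos (x := x)
  rwa [derivWithin_of_isOpen isOpen_Ioi hx, hd.deriv] at h

end HalfLine

/-- The derivative of a decreasing function cannot vanish where its own derivative does not. -/
lemma deriv_neg_of_antitoneOn_Ioi {f f' f'' : ℝ → ℝ} (hf : AntitoneOn f (Set.Ioi 0))
    (hd : ∀ x > 0, HasDerivAt f (f' x) x) (hd2 : ∀ x > 0, HasDerivAt f' (f'' x) x)
    (hne : ∀ x > 0, f' x = 0 → f'' x ≠ 0) {x : ℝ} (hx : 0 < x) : f' x < 0 := by
  refine lt_of_le_of_ne (deriv_nonpos_of_antitoneOn_Ioi hf hx (hd x hx)) fun h0 => hne x hx h0 ?_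
  refine IsLocalMax.hasDerivAt_eq_zero (f := f') ?_ (hd2 x hx)
  filter_upwards [Ioi_mem_nhds hx] with y hy
  rw [h0]
  exact deriv_nonpos_of_antitoneOn_Ioi hf hy (hd y hy)

lemma hasDerivAt_scale_density {μ σ S' : ℝ → ℝ} {c : ℝ} (hc : 0 < c)
    (hμc : ContinuousOn μ (Set.Ioi 0)) (hσc : ContinuousOn σ (Set.Ioi 0))
    (hσ : ∀ x > 0, 0 < σ x)
    (hS'def : ∀ x > 0, S' x = Real.exp (-(∫ z in c..x, 2 * μ z / σ z ^ 2)))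
    {x : ℝ} (hx : 0 < x) : HasDerivAt S' (-(2 * μ x / σ x ^ 2) * S' x) x := by
  have hcont : ContinuousOn (fun z => 2 * μ z / σ z ^ 2) (Set.Ioi 0) :=
    (continuousOn_const.mul hμc).div (hσc.pow 2) fun z hz => pow_ne_zero 2 (hσ z hz).ne'
  have h := (hasDerivAt_integral_of_continuousOn_Ioi hcont hc hx).neg.exp
  simp only [Pi.neg_apply, ← hS'def x hx] at h
  rw [mul_comm]
  refine h.congr_of_eventuallyEq ?_
  filter_upwards [Ioi_mem_nhds hx] with y hy using hS'def y hy

/-- J(x) = (γ − (R_λπ_γ)'(x)) / φ_λ'(x) is differentiable on (0,∞) and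
    J'(x) = (2 S'(x) / (σ²(x) φ_λ'(x)²)) L(x) for all x > 0. -/
theorem stmt_7
    (μ σ pf : ℝ → ℝ) (c : ℝ) (hc : 0 < c)
    (hμc : ContinuousOn μ (Set.Ioi 0)) (hσc : ContinuousOn σ (Set.Ioi 0))
    (hσ : ∀ x > 0, 0 < σ x)
    (S' m' : ℝ → ℝ)
    (hS'def : ∀ x > 0, S' x = Real.exp (-(∫ z in c..x, 2 * μ z / σ z ^ 2)))
    (hm'def : ∀ x > 0, m' x = 2 / (σ x ^ 2 * S' x))
    (m0 : ℝ → ℝ) (hm0def : ∀ x > 0, m0 x = ∫ z in Set.Ioc 0 x, m' z)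
    (lam : ℝ) (hlam : 0 < lam)
    (φ φ' φ'' : ℝ → ℝ)
    (hφd : ∀ x > 0, HasDerivAt φ (φ' x) x)
    (hφd2 : ∀ x > 0, HasDerivAt φ' (φ'' x) x)
    (hφ''c : ContinuousOn φ'' (Set.Ioi 0))
    (hφpos : ∀ x > 0, 0 < φ x)
    (hφanti : StrictAntiOn φ (Set.Ioi 0))
    (hodeφ : ∀ x > 0, μ x * φ' x + σ x ^ 2 / 2 * φ'' x = lam * φ x)
    (ψ ψ' ψ'' : ℝ → ℝ)
    (hψd : ∀ x > 0, HasDerivAt ψ (ψ' x) x)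
    (hψd2 : ∀ x > 0, HasDerivAt ψ' (ψ'' x) x)
    (hψ''c : ContinuousOn ψ'' (Set.Ioi 0))
    (hψpos : ∀ x > 0, 0 < ψ x)
    (hψmono : StrictMonoOn ψ (Set.Ioi 0))
    (hodeψ : ∀ x > 0, μ x * ψ' x + σ x ^ 2 / 2 * ψ'' x = lam * ψ x)
    (B : ℝ) (hB : ∀ x > 0, (ψ' x * φ x - φ' x * ψ x) / S' x = B)
    (hpfc : ContinuousOn pf (Set.Ioi 0)) (hpfnn : ∀ x > 0, 0 ≤ pf x)
    (γ : ℝ) (hγ : 0 < γ)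
    (pmu : ℝ → ℝ) (hpmudef : ∀ x > 0, pmu x = pf x + γ * μ x)
    (pg : ℝ → ℝ) (hpgdef : ∀ x > 0, pg x = pf x + γ * (lam * x))
    (R R' : ℝ → ℝ)
    (hRdef : ∀ x > 0,
      R x = B⁻¹ * ψ x * (∫ z in Set.Ioi x, φ z * pg z * m' z)
        + B⁻¹ * φ x * (∫ z in Set.Ioc 0 x, ψ z * pg z * m' z))
    (hRd : ∀ x > 0, HasDerivAt R (R' x) x)
    (L : ℝ → ℝ)
    (hLdef : ∀ x > 0,
      L x = lam * (∫ z in Set.Ioi x, pmu z * φ z * m' z) + φ' x / S' x * pmu x)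
    (hint1 : ∀ x > 0,
      IntegrableOn (fun z => φ z * (1 + z + |pg z| + |pmu z|) * m' z) (Set.Ioi x))
    (hint2 : ∀ x > 0, IntegrableOn (fun z => ψ z * |pg z| * m' z) (Set.Ioc 0 x))
    (hφStop : Tendsto (fun x => φ' x / S' x) atTop (nhds 0))
    (hlim2 : Tendsto (fun x => (x * φ' x - φ x) / S' x) atTop (nhds 0)) :
    ∀ x > 0, HasDerivAt (fun y => (γ - R' y) / φ' y)
      (2 * S' x / (σ x ^ 2 * φ' x ^ 2) * L x) x := by
  have hS'pos : ∀ x > 0, 0 < S' x := fun x hx => by rw [hS'def x hx]; exact Real.exp_pos _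
  have hS'd : ∀ x > 0, HasDerivAt S' (-(2 * μ x / σ x ^ 2) * S' x) x := fun x hx =>
    hasDerivAt_scale_density hc hμc hσc hσ hS'def hx
  have hm'pos : ∀ x > 0, 0 < m' x := fun x hx => by
    have := hS'pos x hx
    have := hσ x hx
    rw [hm'def x hx]; positivity
  have hφ'neg : ∀ x > 0, φ' x < 0 := fun x hx =>
    deriv_neg_of_antitoneOn_Ioi hφanti.antitoneOn hφd hφd2 (fun y hy h0 h1 => by
      have h := hodeφ y hy
      rw [h0, h1] at h
      have := mul_pos hlam (hφpos y hy)
      linarith) hx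
  have hψ'nn : ∀ x > 0, 0 ≤ ψ' x := fun x hx =>
    deriv_nonneg_of_monotoneOn_Ioi hψmono.monotoneOn hx (hψd x hx)
  have hW : ∀ x > 0, ψ' x * φ x - φ' x * ψ x = B * S' x := fun x hx => by
    rw [← hB x hx, div_mul_cancel₀ _ (hS'pos x hx).ne']
  have hB0 : B ≠ 0 := by
    intro h0
    have h := hW 1 one_pos
    have h1 := mul_nonneg (hψ'nn 1 one_pos) (hφpos 1 one_pos).le
    have h2 := mul_neg_of_neg_of_pos (hφ'neg 1 one_pos) (hψpos 1 one_pos)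
    rw [h0] at h
    linarith
  have hφc : ContinuousOn φ (Set.Ioi 0) := fun x hx => (hφd x hx).continuousAt.continuousWithinAt
  have hψc : ContinuousOn ψ (Set.Ioi 0) := fun x hx => (hψd x hx).continuousAt.continuousWithinAt
  have hS'c : ContinuousOn S' (Set.Ioi 0) :=
    fun x hx => (hS'd x hx).continuousAt.continuousWithinAt
  have hm'c : ContinuousOn m' (Set.Ioi 0) :=
    (continuousOn_const.div ((hσc.pow 2).mul hS'c) fun z hz =>
      mul_ne_zero (pow_ne_zero 2 (hσ z hz).ne') (hS'pos z hz).ne').congr hm'def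
  have hpmuc : ContinuousOn pmu (Set.Ioi 0) :=
    (hpfc.add (continuousOn_const.mul hμc)).congr hpmudef
  have hpgc : ContinuousOn pg (Set.Ioi 0) :=
    (hpfc.add (continuousOn_const.mul (continuousOn_const.mul continuousOn_id))).congr hpgdef
  have hFc := (hφc.mul hpgc).mul hm'c
  have hGc := (hψc.mul hpgc).mul hm'c
  have hHc := (hpmuc.mul hφc).mul hm'c
  have hFint : ∀ x > 0, IntegrableOn (fun z => φ z * pg z * m' z) (Set.Ioi x) := fun x hx => by
    refine integrableOn_of_continuousOn_of_abs_le measurableSet_Ioi (hint1 x hx)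
      (hFc.mono (Set.Ioi_subset_Ioi (le_of_lt hx))) fun z hz => ?_
    have hz0 : 0 < z := hx.trans hz
    rw [abs_mul, abs_mul, abs_of_pos (hφpos z hz0), abs_of_pos (hm'pos z hz0)]
    refine mul_le_mul_of_nonneg_right (mul_le_mul_of_nonneg_left ?_ (hφpos z hz0).le)
      (hm'pos z hz0).le
    linarith [abs_nonneg (pmu z)]
  have hHint : ∀ x > 0, IntegrableOn (fun z => pmu z * φ z * m' z) (Set.Ioi x) := fun x hx => by
    refine integrableOn_of_continuousOn_of_abs_le measurableSet_Ioi (hint1 x hx)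
      (hHc.mono (Set.Ioi_subset_Ioi (le_of_lt hx))) fun z hz => ?_
    have hz0 : 0 < z := hx.trans hz
    rw [abs_mul, abs_mul, abs_of_pos (hφpos z hz0), abs_of_pos (hm'pos z hz0), mul_comm |pmu z|]
    refine mul_le_mul_of_nonneg_right (mul_le_mul_of_nonneg_left ?_ (hφpos z hz0).le)
      (hm'pos z hz0).le
    linarith [abs_nonneg (pg z)]
  have hGint : ∀ x > 0, IntegrableOn (fun z => ψ z * pg z * m' z) (Set.Ioc 0 x) := fun x hx => by
    refine integrableOn_of_continuousOn_of_abs_le measurableSet_Ioc (hint2 x hx)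
      (hGc.mono Set.Ioc_subset_Ioi_self) fun z hz => ?_
    rw [abs_mul, abs_mul, abs_of_pos (hψpos z hz.1), abs_of_pos (hm'pos z hz.1)]
  set F : ℝ → ℝ := fun y => ∫ z in Set.Ioi y, φ z * pg z * m' z with hF
  set G : ℝ → ℝ := fun y => ∫ z in Set.Ioc 0 y, ψ z * pg z * m' z with hG
  have hFd : ∀ x > 0, HasDerivAt F (-(φ x * pg x * m' x)) x := fun x hx =>
    hasDerivAt_setIntegral_Ioi hFc hFint hx
  have hGd : ∀ x > 0, HasDerivAt G (ψ x * pg x * m' x) x := fun x hx =>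
    hasDerivAt_setIntegral_Ioc hGc hGint hx
  have hR' : ∀ x > 0, R' x = B⁻¹ * ψ' x * F x + B⁻¹ * φ' x * G x := fun x hx => by
    have h := ((((hψd x hx).const_mul B⁻¹).mul (hFd x hx)).add
      (((hφd x hx).const_mul B⁻¹).mul (hGd x hx))).congr_of_eventuallyEq (f₁ := R) (by
        filter_upwards [Ioi_mem_nhds hx] with y hy using hRdef y hy)
    rw [(hRd x hx).unique h]
    ring
  -- Dynkin's formula for the identity, in integrated form.
  have hId : ∀ x > 0, γ * (x * φ' x - φ x) / S' x =
      (∫ z in Set.Ioi x, pmu z * φ z * m' z) - F x := fun x hx => by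
    have hd : ∀ y ∈ Set.Ici x, HasDerivAt (fun y => γ * ((y * φ' y - φ y) / S' y))
        (φ y * pg y * m' y - pmu y * φ y * m' y) y := fun y hy => by
      have hy0 : 0 < y := lt_of_lt_of_le hx hy
      have hS0 := (hS'pos y hy0).ne'
      have hσ0 := (hσ y hy0).ne'
      refine (((((hasDerivAt_id y).mul (hφd2 y hy0)).sub (hφd y hy0)).div
        (hS'd y hy0) hS0).const_mul γ).congr_deriv ?_
      simp only [id, Pi.mul_apply, Pi.sub_apply]
      rw [hm'def y hy0, hpmudef y hy0, hpgdef y hy0]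
      field_simp
      linear_combination (2 * y * γ) * hodeφ y hy0
    have h := integral_Ioi_of_hasDerivAt_of_tendsto' hd ((hFint x hx).sub (hHint x hx))
      (hlim2.const_mul γ)
    rw [integral_sub (hFint x hx) (hHint x hx)] at h
    rw [mul_div_assoc]
    linarith
  intro x hx
  have hS0 := (hS'pos x hx).ne'
  have hσ0 := (hσ x hx).ne'
  have hφ0 := (hφ'neg x hx).ne
  have hR'd := ((((hψd2 x hx).const_mul B⁻¹).mul (hFd x hx)).add
      (((hφd2 x hx).const_mul B⁻¹).mul (hGd x hx))).congr_of_eventuallyEq (f₁ := R') (by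
        filter_upwards [Ioi_mem_nhds hx] with y hy using hR' y hy)
  refine ((hR'd.const_sub γ).div (hφd2 x hx) hφ0).congr_deriv ?_
  have hφ'' : φ'' x = 2 * (lam * φ x - μ x * φ' x) / σ x ^ 2 := by
    rw [← hodeφ x hx]; field_simp; ring
  have hψ'' : ψ'' x = 2 * (lam * ψ x - μ x * ψ' x) / σ x ^ 2 := by
    rw [← hodeψ x hx]; field_simp; ring
  have hH : (∫ z in Set.Ioi x, pmu z * φ z * m' z) =
      F x + γ * (x * φ' x - φ x) / S' x := by
    rw [hId x hx]; ring
  rw [hLdef x hx, hH, hR' x hx, hφ'', hψ'', hm'def x hx, hpmudef x hx, hpgdef x hx]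
  have hφx := (hφpos x hx).ne'
  have hψ'x : ψ' x = (B * S' x + φ' x * ψ x) / φ x := by
    rw [← hW x hx]; field_simp; ring
  rw [hψ'x]
  field_simp
  ring
end

section
/- For every x > 0, φ_λ(x) φ_{λ+r}'(x) − φ_{λ+r}(x) φ_λ'(x) = −r S'(x) ∫_x^∞ φ_λ(y) φ_{λ+r}(y) m'(y) dy ≤ 0; consequently φ_λ(x)/φ_{λ+r}(x) ≥ φ_λ'(x)/φ_{λ+r}'(x) for every x > 0. -/
open MeasureTheory Filter

/-- The scale density solves its first order linear equation. -/
theorem hasDerivAt_exp_neg_integral {a : ℝ → ℝ} {c x : ℝ} (hc : 0 < c) (hx : 0 < x)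
    (ha : ContinuousOn a (Set.Ioi 0)) :
    HasDerivAt (fun y => Real.exp (-(∫ z in c..y, a z)))
      (-a x * Real.exp (-(∫ z in c..x, a z))) x := by
  have hsub : Set.uIcc c x ⊆ Set.Ioi 0 := fun z hz => lt_of_lt_of_le (lt_min hc hx) hz.1
  have h := intervalIntegral.integral_hasDerivAt_right
    ((ha.mono hsub).intervalIntegrable)
    (ha.stronglyMeasurableAtFilter isOpen_Ioi x hx)
    (ha.continuousAt (Ioi_mem_nhds hx))
  exact h.neg.exp.congr_deriv (mul_comm _ _)

/-- The Wronskian of solutions of `m f' + s² / 2 f'' = k f` and `m g' + s² / 2 g'' = (k + r) g`,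
divided by the scale density `S`, has derivative `r f g` times the speed density. -/
theorem hasDerivAt_wronskian_div_scale {S f f' g g' : ℝ → ℝ} {x m s k r f'' g'' : ℝ}
    (hs : 0 < s) (hSpos : 0 < S x) (hS : HasDerivAt S (-(2 * m / s ^ 2) * S x) x)
    (hf : HasDerivAt f (f' x) x) (hf' : HasDerivAt f' f'' x)
    (hg : HasDerivAt g (g' x) x) (hg' : HasDerivAt g' g'' x)
    (odef : m * f' x + s ^ 2 / 2 * f'' = k * f x)
    (odeg : m * g' x + s ^ 2 / 2 * g'' = (k + r) * g x) :
    HasDerivAt (fun y => (f y * g' y - g y * f' y) / S y)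
      (r * (f x * g x * (2 / (s ^ 2 * S x)))) x := by
  refine (((hf.mul hg').sub (hg.mul hf')).div hS hSpos.ne').congr_deriv ?_
  have hf2 : f'' = (k * f x - m * f' x) * 2 / s ^ 2 := by
    field_simp
    linarith
  have hg2 : g'' = ((k + r) * g x - m * g' x) * 2 / s ^ 2 := by
    field_simp
    linarith
  rw [hf2, hg2]
  simp only [Pi.sub_apply, Pi.mul_apply]
  field_simp
  ring

/-- For every x > 0,
    φ_λ(x) φ_{λ+r}'(x) − φ_{λ+r}(x) φ_λ'(x) = −r S'(x) ∫_x^∞ φ_λ φ_{λ+r} m' ≤ 0;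
    consequently φ_λ(x)/φ_{λ+r}(x) ≥ φ_λ'(x)/φ_{λ+r}'(x). -/
theorem stmt_14
    (μ σ : ℝ → ℝ) (c : ℝ) (hc : 0 < c)
    (hμc : ContinuousOn μ (Set.Ioi 0)) (hσc : ContinuousOn σ (Set.Ioi 0))
    (hσ : ∀ x > 0, 0 < σ x)
    (S' m' : ℝ → ℝ)
    (hS'def : ∀ x > 0, S' x = Real.exp (-(∫ z in c..x, 2 * μ z / σ z ^ 2)))
    (hm'def : ∀ x > 0, m' x = 2 / (σ x ^ 2 * S' x))
    (lam r : ℝ) (hlam : 0 < lam) (hr : 0 < r)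
    (φl φl' φl'' : ℝ → ℝ)
    (hφld : ∀ x > 0, HasDerivAt φl (φl' x) x)
    (hφld2 : ∀ x > 0, HasDerivAt φl' (φl'' x) x)
    (hφl''c : ContinuousOn φl'' (Set.Ioi 0))
    (hφlpos : ∀ x > 0, 0 < φl x)
    (hφlanti : StrictAntiOn φl (Set.Ioi 0))
    (hodel : ∀ x > 0, μ x * φl' x + σ x ^ 2 / 2 * φl'' x = lam * φl x)
    (φr φr' φr'' : ℝ → ℝ)
    (hφrd : ∀ x > 0, HasDerivAt φr (φr' x) x)
    (hφrd2 : ∀ x > 0, HasDerivAt φr' (φr'' x) x)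
    (hφr''c : ContinuousOn φr'' (Set.Ioi 0))
    (hφrpos : ∀ x > 0, 0 < φr x)
    (hφranti : StrictAntiOn φr (Set.Ioi 0))
    (hoder : ∀ x > 0, μ x * φr' x + σ x ^ 2 / 2 * φr'' x = (lam + r) * φr x)
    (hlim : Tendsto (fun x => (φl x * φr' x - φr x * φl' x) / S' x) atTop (nhds 0))
    (hint : ∀ x > 0, IntegrableOn (fun y => φl y * φr y * m' y) (Set.Ioi x)) :
    ∀ x > 0,
      (φl x * φr' x - φr x * φl' x
          = -r * S' x * ∫ y in Set.Ioi x, φl y * φr y * m' y) ∧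
      φl x * φr' x - φr x * φl' x ≤ 0 ∧
      φl' x / φr' x ≤ φl x / φr x := by
  have hSpos : ∀ x > 0, 0 < S' x := fun x hx => by rw [hS'def x hx]; positivity
  have ha : ContinuousOn (fun z => 2 * μ z / σ z ^ 2) (Set.Ioi 0) :=
    (continuousOn_const.mul hμc).div (hσc.pow 2) fun z hz => (pow_pos (hσ z hz) 2).ne'
  have hSd : ∀ x > 0, HasDerivAt S' (-(2 * μ x / σ x ^ 2) * S' x) x := fun x hx => by
    rw [hS'def x hx]
    exact (hasDerivAt_exp_neg_integral hc hx ha).congr_of_eventuallyEq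
      (Filter.eventually_of_mem (Ioi_mem_nhds hx) hS'def)
  have hWd : ∀ x > 0, HasDerivAt (fun y => (φl y * φr' y - φr y * φl' y) / S' y)
      (r * (φl x * φr x * m' x)) x := fun x hx => by
    rw [hm'def x hx]
    exact hasDerivAt_wronskian_div_scale (hσ x hx) (hSpos x hx) (hSd x hx) (hφld x hx)
      (hφld2 x hx) (hφrd x hx) (hφrd2 x hx) (hodel x hx) (hoder x hx)
  intro x hx
  have hSx := hSpos x hx
  have hlx := hφlpos x hx
  have hrx := hφrpos x hx
  have heq : φl x * φr' x - φr x * φl' x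
      = -r * S' x * ∫ y in Set.Ioi x, φl y * φr y * m' y := by
    have h := integral_Ioi_of_hasDerivAt_of_tendsto' (a := x)
      (fun y hy => hWd y (lt_of_lt_of_le hx hy)) ((hint x hx).const_mul r) hlim
    rw [integral_const_mul] at h
    field_simp at h
    linarith
  have hnonneg : 0 ≤ ∫ y in Set.Ioi x, φl y * φr y * m' y := by
    refine setIntegral_nonneg measurableSet_Ioi fun y hy => ?_
    have hy0 : 0 < y := hx.trans hy
    have hly := hφlpos y hy0
    have hry := hφrpos y hy0
    have hSy := hSpos y hy0
    rw [hm'def y hy0]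
    positivity
  have hle : φl x * φr' x - φr x * φl' x ≤ 0 := by
    rw [heq]
    have := mul_nonneg (mul_pos hr hSx).le hnonneg
    linarith
  have hφr'le : φr' x ≤ 0 := by
    rw [← (hφrd x hx).deriv, ← derivWithin_of_isOpen isOpen_Ioi hx]
    exact hφranti.antitoneOn.derivWithin_nonpos
  refine ⟨heq, hle, ?_⟩
  rcases hφr'le.eq_or_lt with h0 | hneg
  · rw [h0, div_zero]
    positivity
  · rw [div_le_iff_of_neg hneg, div_mul_eq_mul_div, div_le_iff₀ hrx]
    linarith
end
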